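/- Let A be a DFA, P ⊆ Σ* a live complete set for A with λ ∈ P, and V ⊆ Σ* with λ ∈ V such that V is closed for P, and let rep be any representative function for (V, P). Then the run of the hypothesis DFA M = M(A, V, P, rep) computes rows: for every string α ∈ Σ*, the state reached by M from its start state E_V(λ) on input α equals E_V(α). -/

import Mathlib

/-- The row of a string `x` with respect to a set `V` of distinguishing strings:
`E_V(x) = {v ∈ V : x ++ v ∈ L(A)}`. -/
def row {α σ : Type*} (A : DFA α σ) (V : Set (List α)) (x : List α) : Set (List α) :=
  {v ∈ V | x ++ v ∈ A.accepts}

/-- A state is live if some string leads from it to an accepting state. -/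
def Live {α σ : Type*} (A : DFA α σ) (q : σ) : Prop :=
  ∃ w : List α, A.evalFrom q w ∈ A.accept

/-- A finite set `P` of strings is live complete for `A` if every live state is reached
from the initial state by some string of `P`. -/
def LiveComplete {α σ : Type*} (A : DFA α σ) (P : Set (List α)) : Prop :=
  P.Finite ∧ ∀ q : σ, Live A q → ∃ a ∈ P, A.eval a = q

/-- `V` is closed for `P`: (a) equal rows of members of `P` remain equal after any
one-symbol extension, and (b) empty rows of members of `P` remain empty after any
one-symbol extension. -/
def ClosedFor {α σ : Type*} (A : DFA α σ) (V P : Set (List α)) : Prop :=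
  (∀ a ∈ P, ∀ c ∈ P, ∀ b : α,
      row A V a = row A V c → row A V (a ++ [b]) = row A V (c ++ [b])) ∧
  (∀ a ∈ P, ∀ b : α, row A V a = ∅ → row A V (a ++ [b]) = ∅)

/-- `rep` is a representative function for `(V, P)`: it assigns to each nonempty row of a
string of `P` a string of `P` having that row. -/
def IsRepFun {α σ : Type*} (A : DFA α σ) (V P : Set (List α))
    (rep : Set (List α) → List α) : Prop :=
  ∀ r : Set (List α), (∃ a ∈ P, row A V a = r) → r ≠ ∅ →
    rep r ∈ P ∧ row A V (rep r) = r

open Classical in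
/-- The transition function of the hypothesis DFA: on a nonempty row of a string of `P`,
step via a representative; on all other state names, go to the empty (dead) state. -/
noncomputable def hypStep {α σ : Type*} (A : DFA α σ) (V P : Set (List α))
    (rep : Set (List α) → List α) (r : Set (List α)) (b : α) : Set (List α) :=
  if (∃ a ∈ P, row A V a = r) ∧ r ≠ ∅ then row A V (rep r ++ [b]) else ∅

/-- The hypothesis DFA `M(A, V, P, rep)`: states are subsets of `Σ*`, the start state is
`E_V(λ)`, accepting states are the rows containing `λ`, and transitions are `hypStep`. -/
noncomputable def hypDFA {α σ : Type*} (A : DFA α σ) (V P : Set (List α))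
    (rep : Set (List α) → List α) : DFA α (Set (List α)) where
  step := hypStep A V P rep
  start := row A V []
  accept := {r : Set (List α) | [] ∈ r}

theorem row_congr {α σ : Type*} {A : DFA α σ} (V : Set (List α)) {x y : List α}
    (h : A.eval x = A.eval y) : row A V x = row A V y := by
  ext v
  simp only [row, Set.mem_ofPred_eq, DFA.mem_accepts, DFA.eval, DFA.evalFrom_of_append] at h ⊢
  rw [h]

theorem eval_append_congr {α σ : Type*} {A : DFA α σ} {x y : List α}
    (h : A.eval x = A.eval y) (z : List α) : A.eval (x ++ z) = A.eval (y ++ z) := by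
  simp only [DFA.eval, DFA.evalFrom_of_append] at h ⊢
  rw [h]

theorem row_append_eq_empty_of_not_live {α σ : Type*} {A : DFA α σ} (V : Set (List α))
    {x : List α} (h : ¬ Live A (A.eval x)) (z : List α) : row A V (x ++ z) = ∅ := by
  refine Set.eq_empty_iff_forall_notMem.2 fun v hv => h ⟨z ++ v, ?_⟩
  have hacc := hv.2
  rwa [DFA.mem_accepts, List.append_assoc, DFA.eval, DFA.evalFrom_of_append] at hacc

theorem hypStep_empty {α σ : Type*} (A : DFA α σ) (V P : Set (List α))
    (rep : Set (List α) → List α) (b : α) : hypStep A V P rep ∅ b = ∅ := by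
  simp [hypStep]

theorem hypStep_row_of_mem {α σ : Type*} {A : DFA α σ} {V P : Set (List α)}
    (hcl : ClosedFor A V P) {rep : Set (List α) → List α} (hrep : IsRepFun A V P rep)
    {a : List α} (ha : a ∈ P) (b : α) :
    hypStep A V P rep (row A V a) b = row A V (a ++ [b]) := by
  by_cases hne : row A V a = ∅
  · rw [hcl.2 a ha b hne, hne, hypStep_empty]
  · obtain ⟨hmem, hrow⟩ := hrep _ ⟨a, ha, rfl⟩ hne
    rw [hypStep, if_pos ⟨⟨a, ha, rfl⟩, hne⟩]
    exact hcl.1 _ hmem a ha b hrow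

theorem hypStep_row {α σ : Type*} {A : DFA α σ} {V P : Set (List α)}
    (hP : LiveComplete A P) (hcl : ClosedFor A V P) {rep : Set (List α) → List α}
    (hrep : IsRepFun A V P rep) (x : List α) (b : α) :
    hypStep A V P rep (row A V x) b = row A V (x ++ [b]) := by
  by_cases hlive : Live A (A.eval x)
  · obtain ⟨a, ha, hax⟩ := hP.2 _ hlive
    rw [← row_congr V hax, ← row_congr V (eval_append_congr hax [b])]
    exact hypStep_row_of_mem hcl hrep ha b
  · have hx : row A V x = ∅ := by simpa using row_append_eq_empty_of_not_live V hlive []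
    rw [hx, row_append_eq_empty_of_not_live V hlive, hypStep_empty]

/-- The run of the hypothesis DFA computes rows: from its start state `E_V(λ)`, on any
input string `α`, the hypothesis DFA reaches the state `E_V(α)`. -/
theorem hypDFA_eval_eq_row {α σ : Type*} [Fintype α] [Fintype σ]
    (A : DFA α σ) (V P : Set (List α)) (hP : LiveComplete A P)
    (hnilP : ([] : List α) ∈ P) (hnilV : ([] : List α) ∈ V) (hcl : ClosedFor A V P)
    (rep : Set (List α) → List α) (hrep : IsRepFun A V P rep) :
    ∀ x : List α, (hypDFA A V P rep).eval x = row A V x := by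
  intro x
  induction x using List.reverseRecOn with
  | nil => rfl
  | append_singleton x b ih =>
    rw [DFA.eval_append_singleton, ih]
    exact hypStep_row hP hcl hrep x b
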